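/- Let X ⊂ P^4 be an irreducible hypersurface covered by the lines of a family Σ of dimension 2 whose Fano scheme is generically reduced, and let r ∈ Σ be a general line. Then there is no plane M containing r such that M ⊂ T_qX for every general (smooth) point q of r; that is, no plane through r is tangent to X at every general point of r. -/

import Mathlib

open MvPolynomial

noncomputable section

namespace PaperLines

variable (K : Type) [Field K]

/-- Projective `N`-space over `K`, as the projectivization of `K^{N+1}`. -/
abbrev PP (N : ℕ) := Projectivization K (Fin (N + 1) → K)

/-- The zero locus in `ℙ^N` of a (homogeneous) polynomial. -/
def projZeros {N : ℕ} (F : MvPolynomial (Fin (N + 1)) K) : Set (PP K N) :=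
  {x | ∀ v ∈ x.submodule, eval v F = 0}

/-- The projective linear subspace associated to a linear subspace `W ⊆ K^{N+1}`. -/
def projLinear {N : ℕ} (W : Submodule K (Fin (N + 1) → K)) : Set (PP K N) :=
  {x | x.submodule ≤ W}

/-- The Grassmannian of `k`-dimensional linear subspaces of `K^{N+1}`
(`k = 2` gives the lines of `ℙ^N`, `k = 3` the planes). -/
def Grass (k N : ℕ) := {W : Submodule K (Fin (N + 1) → K) // Module.finrank K W = k}

/-- The set of lines contained in the hypersurface `{F = 0} ⊆ ℙ^N`. -/
def fanoSet {N : ℕ} (F : MvPolynomial (Fin (N + 1)) K) : Set (Grass K 2 N) :=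
  {W | projLinear K W.1 ⊆ projZeros K F}

/-- `X = {F = 0}` is covered by lines. -/
def CoveredByLines {N : ℕ} (F : MvPolynomial (Fin (N + 1)) K) : Prop :=
  ∀ x ∈ projZeros K F, ∃ W ∈ fanoSet K F, x ∈ projLinear K W.1

/-- The ideal of polynomials vanishing on a subset of affine space `K^σ`. -/
def affVanishing {σ : Type} (S : Set (σ → K)) : Ideal (MvPolynomial σ K) where
  carrier := {f | ∀ v ∈ S, eval v f = 0}
  add_mem' := by
    intro a b ha hb v hv
    simp only [map_add, ha v hv, hb v hv, add_zero]
  zero_mem' := by intro v hv; simp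
  smul_mem' := by
    intro c a ha v hv
    simp only [smul_eq_mul, map_mul, ha v hv, mul_zero]

/-- The dimension of a subset of affine space `K^σ`, as the Krull dimension of its
coordinate ring (this only depends on the Zariski closure). -/
def affDim {σ : Type} (S : Set (σ → K)) : WithBot ℕ∞ :=
  ringKrullDim (MvPolynomial σ K ⧸ affVanishing K S)

/-- The affine cone over a subset of `ℙ^N`. -/
def projCone {N : ℕ} (S : Set (PP K N)) : Set (Fin (N + 1) → K) :=
  {v | ∃ x ∈ S, v ∈ x.submodule}

/-- A subset of `ℙ^N` has (projective) dimension `d`:  its affine cone has dimension `d+1`. -/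
def HasProjDim {N : ℕ} (S : Set (PP K N)) (d : ℕ) : Prop :=
  affDim K (projCone K S) = ((d + 1 : ℕ) : WithBot ℕ∞)

/-- A subset of `ℙ^N` has (projective) dimension at most `d`. -/
def ProjDimLE {N : ℕ} (S : Set (PP K N)) (d : ℕ) : Prop :=
  affDim K (projCone K S) ≤ ((d + 1 : ℕ) : WithBot ℕ∞)

/-- A subset of `ℙ^N` has (projective) dimension at least `d`. -/
def ProjDimGE {N : ℕ} (S : Set (PP K N)) (d : ℕ) : Prop :=
  ((d + 1 : ℕ) : WithBot ℕ∞) ≤ affDim K (projCone K S)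

/-- A `k`-tuple of vectors (a "frame") all lying in the subspace `W`. -/
def frameMem {k N : ℕ} (p : Fin k × Fin (N + 1) → K) (W : Submodule K (Fin (N + 1) → K)) : Prop :=
  ∀ i : Fin k, (fun j => p (i, j)) ∈ W

/-- The "Stiefel cone" over a family of `k`-planes: all `k`-tuples of vectors lying in some
member of the family.  Over a `d`-dimensional family it has dimension `d + k²`. -/
def frameCone (k N : ℕ) (S : Set (Grass K k N)) : Set (Fin k × Fin (N + 1) → K) :=
  {p | ∃ W ∈ S, frameMem K p W.1}

/-- A family of `k`-planes has dimension `d` (computed via its Stiefel cone). -/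
def HasGrDim {k N : ℕ} (S : Set (Grass K k N)) (d : ℕ) : Prop :=
  affDim K (frameCone K k N S) = ((d + k * k : ℕ) : WithBot ℕ∞)

/-- A family of `k`-planes has dimension at least `d`. -/
def GrDimGE {k N : ℕ} (S : Set (Grass K k N)) (d : ℕ) : Prop :=
  ((d + k * k : ℕ) : WithBot ℕ∞) ≤ affDim K (frameCone K k N S)

/-- Zariski-closed subsets of the Grassmannian: common zero sets of families of polynomials
in frame coordinates (vanishing being required for every frame). -/
def GrClosed {k N : ℕ} (S : Set (Grass K k N)) : Prop :=
  ∃ 𝒢 : Set (MvPolynomial (Fin k × Fin (N + 1)) K),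
    S = {W | ∀ G ∈ 𝒢, ∀ p, frameMem K p W.1 → eval p G = 0}

/-- The Zariski closure of a family of `k`-planes in the Grassmannian. -/
def grClosure {k N : ℕ} (S : Set (Grass K k N)) : Set (Grass K k N) :=
  ⋂₀ {C | GrClosed K C ∧ S ⊆ C}

/-- Irreducibility of a family of `k`-planes. -/
def GrIrred {k N : ℕ} (S : Set (Grass K k N)) : Prop :=
  S.Nonempty ∧ ∀ C₁ C₂, GrClosed K C₁ → GrClosed K C₂ → S ⊆ C₁ ∪ C₂ → S ⊆ C₁ ∨ S ⊆ C₂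

/-- `S` is an irreducible component of `T` (a maximal irreducible subset). -/
def IsGrComponentOf {k N : ℕ} (S T : Set (Grass K k N)) : Prop :=
  S ⊆ T ∧ GrIrred K S ∧ ∀ S', S ⊆ S' → S' ⊆ T → GrIrred K S' → S' = S

/-- A property `P` holds for a general member of the family `S` of `k`-planes:
it holds on a nonempty principal open subset of `S`. -/
def GenerallyOnGr {k N : ℕ} (S : Set (Grass K k N)) (P : Grass K k N → Prop) : Prop :=
  ∃ G : MvPolynomial (Fin k × Fin (N + 1)) K,
    (∃ W ∈ S, ∃ p, frameMem K p W.1 ∧ eval p G ≠ 0) ∧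
    ∀ W ∈ S, (∃ p, frameMem K p W.1 ∧ eval p G ≠ 0) → P W

/-- A property `P` holds for a general pair of members of the families `S`, `T`. -/
def GenerallyOnGr2 {k N : ℕ} (S T : Set (Grass K k N))
    (P : Grass K k N → Grass K k N → Prop) : Prop :=
  ∃ G : MvPolynomial ((Fin k × Fin (N + 1)) ⊕ (Fin k × Fin (N + 1))) K,
    (∃ W ∈ S, ∃ W' ∈ T, ∃ p q, frameMem K p W.1 ∧ frameMem K q W'.1 ∧
      eval (Sum.elim p q) G ≠ 0) ∧
    ∀ W ∈ S, ∀ W' ∈ T, (∃ p q, frameMem K p W.1 ∧ frameMem K q W'.1 ∧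
      eval (Sum.elim p q) G ≠ 0) → P W W'

/-- A property `P` holds for a general point of the subset `S ⊆ ℙ^N`. -/
def GenerallyOn {N : ℕ} (S : Set (PP K N)) (P : PP K N → Prop) : Prop :=
  ∃ G : MvPolynomial (Fin (N + 1)) K,
    (∃ x ∈ S, ∃ v ∈ x.submodule, eval v G ≠ 0) ∧
    ∀ x ∈ S, (∃ v ∈ x.submodule, eval v G ≠ 0) → P x

/-- A property `P` holds for a general hyperplane (given by a nonzero linear form `L`). -/
def GenerallyOnHyp {N : ℕ} (P : (Fin (N + 1) → K) → Prop) : Prop :=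
  ∃ G : MvPolynomial (Fin (N + 1)) K,
    (∃ L : Fin (N + 1) → K, L ≠ 0 ∧ eval L G ≠ 0) ∧
    ∀ L : Fin (N + 1) → K, L ≠ 0 → eval L G ≠ 0 → P L

/-- Through a general point of `X = {F = 0}` there pass exactly `μ` lines of the family `Lf`. -/
def HasMuOn {N : ℕ} (Lf : Set (Grass K 2 N)) (F : MvPolynomial (Fin (N + 1)) K)
    (μ : ℕ) : Prop :=
  GenerallyOn K (projZeros K F) (fun x => {W | W ∈ Lf ∧ x ∈ projLinear K W.1}.ncard = μ)

/-- Through a general point of `X = {F = 0}` there pass exactly `μ` lines contained in `X`. -/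
def HasMu {N : ℕ} (F : MvPolynomial (Fin (N + 1)) K) (μ : ℕ) : Prop :=
  HasMuOn K (fanoSet K F) F μ

/-- The ideal of the Fano scheme of lines on `{F = 0}`, in Stiefel (frame) coordinates:
it is generated by the coefficients (in `s,t`) of `F(s·v + t·w)`. -/
def fanoIdeal {N : ℕ} (F : MvPolynomial (Fin (N + 1)) K) :
    Ideal (MvPolynomial (Fin 2 × Fin (N + 1)) K) :=
  Ideal.span {g | ∃ d : Fin 2 →₀ ℕ, g = coeff d
    (aeval (fun j : Fin (N + 1) =>
      (X 0 : MvPolynomial (Fin 2) (MvPolynomial (Fin 2 × Fin (N + 1)) K)) * C (X (0, j)) +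
        X 1 * C (X (1, j))) F)}

/-- An ideal is generically reduced: at every minimal prime `p` over `I`, the localization
of `R/I` is reduced, i.e. `I_p = p_p`. -/
def GenericallyReducedIdeal {R : Type} [CommRing R] (I : Ideal R) : Prop :=
  ∀ p ∈ I.minimalPrimes, ∀ x ∈ p, ∃ s, s ∉ p ∧ s * x ∈ I

/-- The Fano scheme of lines on `{F = 0}` is generically reduced. -/
def FanoGenerallyReduced {N : ℕ} (F : MvPolynomial (Fin (N + 1)) K) : Prop :=
  GenericallyReducedIdeal (fanoIdeal K F)

/-- The prime (in frame coordinates) corresponding to a point `r` of the Grassmannian of lines. -/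
def framePrime {N : ℕ} (r : Grass K 2 N) : Ideal (MvPolynomial (Fin 2 × Fin (N + 1)) K) :=
  affVanishing K (frameCone K 2 N {r})

/-- The Fano scheme of lines on `{F = 0}` is reduced at the line `r`. -/
def FanoReducedAt {N : ℕ} (F : MvPolynomial (Fin (N + 1)) K) (r : Grass K 2 N) : Prop :=
  ∀ x ∈ framePrime K r, ∃ s, s ∉ framePrime K r ∧ s * x ∈ fanoIdeal K F

/-- The Fano scheme is reduced at the generic point of the component `Fam`. -/
def ComponentGenerallyReduced {N : ℕ} (F : MvPolynomial (Fin (N + 1)) K)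
    (Fam : Set (Grass K 2 N)) : Prop :=
  ∀ x ∈ affVanishing K (frameCone K 2 N Fam),
    ∃ s, s ∉ affVanishing K (frameCone K 2 N Fam) ∧ s * x ∈ fanoIdeal K F

/-- The gradient vector of `F` at `v`. -/
def gradVec {N : ℕ} (F : MvPolynomial (Fin (N + 1)) K) (v : Fin (N + 1) → K) :
    Fin (N + 1) → K :=
  fun i => eval v (pderiv i F)

/-- The singular locus of the hypersurface `{F = 0}`. -/
def singLocus {N : ℕ} (F : MvPolynomial (Fin (N + 1)) K) : Set (PP K N) :=
  {x | x ∈ projZeros K F ∧ ∀ v ∈ x.submodule, gradVec K F v = 0}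

/-- `x` is a smooth point of the hypersurface `{F = 0}`. -/
def SmoothAt {N : ℕ} (F : MvPolynomial (Fin (N + 1)) K) (x : PP K N) : Prop :=
  x ∈ projZeros K F ∧ x ∉ singLocus K F

/-- The embedded tangent hyperplane to `{F = 0}` at a (smooth) point `x`. -/
def tangentHyp {N : ℕ} (F : MvPolynomial (Fin (N + 1)) K) (x : PP K N) : Set (PP K N) :=
  {y | ∀ v ∈ x.submodule, ∀ w ∈ y.submodule, ∑ i, gradVec K F v i * w i = 0}

/-- The hyperplane of `ℙ^N` with coefficient vector `L`. -/
def hypSet {N : ℕ} (L : Fin (N + 1) → K) : Set (PP K N) :=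
  {x | ∀ v ∈ x.submodule, ∑ i, L i * v i = 0}

/-- A quadric surface in `ℙ⁴`: a two-dimensional intersection of a quadric and a hyperplane. -/
def IsQuadricSurface (Q : Set (PP K 4)) : Prop :=
  ∃ (q : MvPolynomial (Fin 5) K) (W : Submodule K (Fin 5 → K)),
    q.IsHomogeneous 2 ∧ Module.finrank K W = 4 ∧
    Q = projZeros K q ∩ projLinear K W ∧ HasProjDim K Q 2

/-- `X = {F = 0}` is (birationally) ruled by quadrics over a curve: it is covered by a
one-dimensional family of quadric surfaces with exactly one member through a general point. -/
def QuadricBundle (F : MvPolynomial (Fin 5) K) : Prop :=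
  ∃ 𝒬 : Set (Set (PP K 4)),
    (∀ Q ∈ 𝒬, IsQuadricSurface K Q ∧ Q ⊆ projZeros K F) ∧
    GenerallyOn K (projZeros K F) (fun x => ∃! Q, Q ∈ 𝒬 ∧ x ∈ Q)

/-- The degree of a `d`-dimensional subset `S ⊆ ℙ^N`: the largest finite number of points in
which a linear subspace of complementary dimension meets `S`. -/
def projDegree {N : ℕ} (S : Set (PP K N)) (d : ℕ) : ℕ :=
  sSup {m | ∃ W : Submodule K (Fin (N + 1) → K), Module.finrank K W = N + 1 - d ∧
    (S ∩ projLinear K W).Finite ∧ (S ∩ projLinear K W).ncard = m}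

/-- Zariski-closed subsets of `ℙ^N`. -/
def ProjClosed {N : ℕ} (S : Set (PP K N)) : Prop :=
  ∃ 𝒮 : Set (MvPolynomial (Fin (N + 1)) K),
    S = {x | ∀ f ∈ 𝒮, ∀ v ∈ x.submodule, eval v f = 0}

/-- The Zariski closure of a subset of `ℙ^N`. -/
def projClosure {N : ℕ} (S : Set (PP K N)) : Set (PP K N) :=
  ⋂₀ {C | ProjClosed K C ∧ S ⊆ C}

/-- The image of a subset of `ℙ^a` under the rational map `ℙ^a ⤏ ℙ^b` induced by a
linear map `T : K^{a+1} → K^{b+1}`. -/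
def projImage {a b : ℕ} (T : (Fin (a + 1) → K) →ₗ[K] (Fin (b + 1) → K))
    (Y : Set (PP K a)) : Set (PP K b) :=
  {x | ∃ y ∈ Y, ∃ v ∈ y.submodule, ∃ h : T v ≠ 0, x = Projectivization.mk K (T v) h}

/-- `Xs ⊆ ℙ^b` is a (linear) projection of `Y ⊆ ℙ^a`. -/
def IsProjectionOf {a b : ℕ} (Xs : Set (PP K b)) (Y : Set (PP K a)) : Prop :=
  ∃ T : (Fin (a + 1) → K) →ₗ[K] (Fin (b + 1) → K),
    Xs = projClosure K (projImage K T Y)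

/-- `Y ⊆ ℙ⁵` is a three-dimensional complete intersection of two quadric hypersurfaces. -/
def IsQuadricIntersection5 (Y : Set (PP K 5)) : Prop :=
  ∃ q₁ q₂ : MvPolynomial (Fin 6) K, q₁.IsHomogeneous 2 ∧ q₂.IsHomogeneous 2 ∧
    Y = projZeros K q₁ ∩ projZeros K q₂ ∧ HasProjDim K Y 3

def idx55 : Fin 25 ≃ Fin 5 × Fin 5 :=
  (finCongr (by norm_num : 25 = 5 * 5)).trans finProdFinEquiv.symm

/-- The Plücker coordinate vector of the pair `(v, w)`. -/
def pluckOf (v w : Fin 5 → K) : Fin 25 → K :=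
  fun kk => v (idx55 kk).1 * w (idx55 kk).2 - v (idx55 kk).2 * w (idx55 kk).1

/-- The Grassmannian `G(1,4)` of lines of `ℙ⁴` in its Plücker embedding. -/
def grassPlucker : Set (PP K 24) :=
  {x | ∃ v w : Fin 5 → K, ∃ h : pluckOf K v w ≠ 0,
    x = Projectivization.mk K (pluckOf K v w) h}

/-- `Y` is a section of the Plücker-embedded `G(1,4)` by a linear `ℙ⁶`. -/
def IsGrassP6Section (Y : Set (PP K 24)) : Prop :=
  ∃ W : Submodule K (Fin 25 → K), Module.finrank K W = 7 ∧
    Y = grassPlucker K ∩ projLinear K W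

def idx33 : Fin 9 ≃ Fin 3 × Fin 3 :=
  (finCongr (by norm_num : 9 = 3 * 3)).trans finProdFinEquiv.symm

def segre22Vec (a b : Fin 3 → K) : Fin 9 → K := fun kk => a (idx33 kk).1 * b (idx33 kk).2

/-- The Segre embedding of `ℙ² × ℙ²` in `ℙ⁸`. -/
def segreP2P2 : Set (PP K 8) :=
  {x | ∃ a b : Fin 3 → K, ∃ h : segre22Vec K a b ≠ 0,
    x = Projectivization.mk K (segre22Vec K a b) h}

def idx222 : Fin 8 ≃ Fin 2 × Fin 2 × Fin 2 :=
  (finCongr (by norm_num : 8 = 2 * 4)).trans (finProdFinEquiv.symm.trans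
    (Equiv.prodCongr (Equiv.refl _)
      ((finCongr (by norm_num : 4 = 2 * 2)).trans finProdFinEquiv.symm)))

def segre111Vec (a b c : Fin 2 → K) : Fin 8 → K :=
  fun kk => a (idx222 kk).1 * b (idx222 kk).2.1 * c (idx222 kk).2.2

/-- The Segre embedding of `ℙ¹ × ℙ¹ × ℙ¹` in `ℙ⁷`. -/
def segreP1P1P1 : Set (PP K 7) :=
  {x | ∃ a b c : Fin 2 → K, ∃ h : segre111Vec K a b c ≠ 0,
    x = Projectivization.mk K (segre111Vec K a b c) h}

def evalVec {m l : ℕ} (f : Fin l → MvPolynomial (Fin m) K) (v : Fin m → K) : Fin l → K :=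
  fun j => eval v (f j)

/-- Two projective sets are birational: there are rational maps, given by homogeneous
polynomials, defined and mutually inverse on general points. -/
def AreBirational {a b : ℕ} (C : Set (PP K a)) (D : Set (PP K b)) : Prop :=
  ∃ (f : Fin (b + 1) → MvPolynomial (Fin (a + 1)) K)
    (g : Fin (a + 1) → MvPolynomial (Fin (b + 1)) K) (d e : ℕ),
    (∀ j, (f j).IsHomogeneous d) ∧ (∀ i, (g i).IsHomogeneous e) ∧
    GenerallyOn K C (fun x => ∃ v ∈ x.submodule, ∃ h : evalVec K f v ≠ 0,
      Projectivization.mk K (evalVec K f v) h ∈ D ∧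
      ∃ h2 : evalVec K g (evalVec K f v) ≠ 0,
        Projectivization.mk K (evalVec K g (evalVec K f v)) h2 = x) ∧
    GenerallyOn K D (fun y => ∃ w ∈ y.submodule, ∃ h : evalVec K g w ≠ 0,
      Projectivization.mk K (evalVec K g w) h ∈ C ∧
      ∃ h2 : evalVec K f (evalVec K g w) ≠ 0,
        Projectivization.mk K (evalVec K f (evalVec K g w)) h2 = y)

/-- A smooth plane cubic curve (its equation). -/
def IsSmoothPlaneCubic (q : MvPolynomial (Fin 3) K) : Prop :=
  q.IsHomogeneous 3 ∧
    ∀ v : Fin 3 → K, v ≠ 0 → eval v q = 0 → (fun i => eval v (pderiv i q)) ≠ 0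

/-- The hypersurface `{F = 0} ⊆ ℙ⁴` has sectional genus one: its general plane section is a
curve birational to a smooth plane cubic (i.e. of geometric genus `1`). -/
def SectionalGenusOne (F : MvPolynomial (Fin 5) K) : Prop :=
  GenerallyOnGr K (Set.univ : Set (Grass K 3 4)) (fun P =>
    ∃ q : MvPolynomial (Fin 3) K, IsSmoothPlaneCubic K q ∧
      AreBirational K (projZeros K F ∩ projLinear K P.1) (projZeros (N := 2) K q))

/-- The length of a module, as the Krull dimension of its lattice of submodules. -/
def moduleLength (R M : Type) [CommRing R] [AddCommGroup M] [Module R M] : WithBot ℕ∞ :=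
  Order.krullDim (Submodule R M)

/-- The length of the localization of `R/I` at (the complement of) `p`:  when `p` is a prime
containing `I` this is the intersection multiplicity of the scheme `V(I)` at `p`. -/
def localLength {R : Type} [CommRing R] (I p : Ideal R) : WithBot ℕ∞ :=
  moduleLength (Localization (Submonoid.closure {s : R | s ∉ p}))
    (LocalizedModule (Submonoid.closure {s : R | s ∉ p}) (R ⧸ I))

/-- The frame-coordinate ideal of the Schubert variety of lines contained in the hyperplane
with coefficient vector `L`. -/
def hypFrameIdeal (L : Fin 5 → K) : Ideal (MvPolynomial (Fin 2 × Fin 5) K) :=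
  Ideal.span {∑ j, C (L j) * X ((0 : Fin 2), j), ∑ j, C (L j) * X ((1 : Fin 2), j)}

/-- The restriction of a polynomial to the line spanned by `v` and `w`, as a binary form in
the parameters. -/
def restrictLine {N : ℕ} (v w : Fin (N + 1) → K) (G : MvPolynomial (Fin (N + 1)) K) :
    MvPolynomial (Fin 2) K :=
  aeval (fun j => C (v j) * X 0 + C (w j) * X 1) G

/-- The homogeneous polynomials vanishing on a subset `S ⊆ ℙ^N`. -/
def homVanishing {N : ℕ} (S : Set (PP K N)) : Set (MvPolynomial (Fin (N + 1)) K) :=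
  {f | ∀ x ∈ S, ∀ v ∈ x.submodule, eval v f = 0}

/-- The embedded (projectivized) tangent space to the subset `S ⊆ ℙ^N` at the point `P`. -/
def projTangentAt {N : ℕ} (S : Set (PP K N)) (P : PP K N) : Set (PP K N) :=
  {y | ∀ f ∈ homVanishing K S, ∀ v ∈ P.submodule, ∀ w ∈ y.submodule,
    ∑ i, eval v (pderiv i f) * w i = 0}

/-- `P` is a smooth point of the surface `S`: its embedded tangent space is a plane. -/
def IsSmoothSurfacePoint {N : ℕ} (S : Set (PP K N)) (P : PP K N) : Prop :=
  P ∈ S ∧ ∃ W : Submodule K (Fin (N + 1) → K), Module.finrank K W = 3 ∧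
    projTangentAt K S P = projLinear K W

/-- The line `L` is tangent to the surface `S` at the smooth point `P`. -/
def IsTangentLineAt {N : ℕ} (S : Set (PP K N)) (L : Grass K 2 N) (P : PP K N) : Prop :=
  IsSmoothSurfacePoint K S P ∧ P ∈ projLinear K L.1 ∧
    projLinear K L.1 ⊆ projTangentAt K S P

/-- The surface `σ(r)`: the union of the lines of the Fano family meeting the line `r`. -/
def sigmaSurf (F : MvPolynomial (Fin 5) K) (r : Grass K 2 4) : Set (PP K 4) :=
  {x | ∃ W ∈ fanoSet K F, (projLinear K W.1 ∩ projLinear K r.1).Nonempty ∧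
    x ∈ projLinear K W.1}

/-- Substitution of a linear endomorphism into a polynomial: `linSubst φ P = P ∘ φ`. -/
def linSubst {m : ℕ} (φ : (Fin m → K) →ₗ[K] (Fin m → K)) (P : MvPolynomial (Fin m) K) :
    MvPolynomial (Fin m) K :=
  aeval (fun i => ∑ j, C (φ (Pi.single j 1) i) * X j) P

/-- Dehomogenization with respect to the coordinate `x₀`. -/
def dehomAt0 {m : ℕ} (P : MvPolynomial (Fin (m + 1)) K) : MvPolynomial (Fin m) K :=
  aeval (fun i : Fin (m + 1) => Fin.cases 1 (fun j => X j) i) P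

/-- The Gauss image (dual variety, up to closure) of the hypersurface `{F = 0} ⊆ ℙ^N`. -/
def dualVariety {N : ℕ} (F : MvPolynomial (Fin (N + 1)) K) : Set (PP K N) :=
  {h | ∃ x, SmoothAt K F x ∧ ∃ v ∈ x.submodule, ∃ hnz : gradVec K F v ≠ 0,
    h = Projectivization.mk K (gradVec K F v) hnz}

theorem natCast_le_ringKrullDim_of_injective_of_isIntegral {k A : Type} [Field k] [CommRing A]
    [IsDomain A] [Algebra k A] {d : ℕ} (g : MvPolynomial (Fin d) k →ₐ[k] A)
    (hg : Function.Injective g) (hint : g.IsIntegral) : (d : WithBot ℕ∞) ≤ ringKrullDim A := by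
  algebraize [g.toRingHom]
  have : Algebra.IsIntegral (MvPolynomial (Fin d) k) A := ⟨hint⟩
  have hd : ringKrullDim (MvPolynomial (Fin d) k) = d := by simp
  have hle : ringKrullDim (MvPolynomial (Fin d) k) ≤ ringKrullDim A := by
    refine iSup_le fun l => ?_
    obtain ⟨P, hP, hPo⟩ := Ideal.exists_ideal_over_prime_of_isIntegral (S := A) l.head.asIdeal ⊥
      (by
        intro x hx
        have hx' : g x = 0 := hx
        rw [(map_eq_zero_iff g hg).1 hx']
        exact zero_mem _)
    obtain ⟨_, hP2⟩ := hPo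
    have : P.LiesOver l.head.asIdeal := ⟨hP2.symm⟩
    obtain ⟨L, hL, -⟩ := Ideal.exists_ltSeries_of_hasGoingUp l P
    rw [← hL]
    exact le_iSup (fun q : LTSeries (PrimeSpectrum A) => ((q.length : ℕ) : WithBot ℕ∞)) L
  rwa [hd] at hle

theorem trdeg_le_of_ringKrullDim_le {k A : Type} [Field k] [CommRing A] [IsDomain A]
    [Algebra k A] [Algebra.FiniteType k A] {n : ℕ} (h : ringKrullDim A ≤ n) :
    Algebra.trdeg k A ≤ n := by
  obtain ⟨d, g, hg, hint⟩ := exists_integral_inj_algHom_of_fg k A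
  have hd := natCast_le_ringKrullDim_of_injective_of_isIntegral g hg hint
  have hdn : d ≤ n := by exact_mod_cast hd.trans h
  have halg : Algebra.IsAlgebraic (Algebra.adjoin k (Set.range fun i => g (X i))) A := by
    constructor
    intro x
    obtain ⟨P, hP, hPx⟩ := hint x
    have hmem : ∀ q, g q ∈ Algebra.adjoin k (Set.range fun i => g (X i)) := fun q => by
      rw [Set.range_comp' g X, ← AlgHom.map_adjoin, adjoin_range_X]
      exact ⟨q, trivial, rfl⟩
    let g' : MvPolynomial (Fin d) k →+* Algebra.adjoin k (Set.range fun i => g (X i)) :=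
      g.toRingHom.codRestrict _ hmem
    have : IsIntegral (Algebra.adjoin k (Set.range fun i => g (X i))) x :=
      ⟨P.map g', hP.map _, by rw [Polynomial.eval₂_map]; exact hPx⟩
    exact this.isAlgebraic
  refine (Algebra.IsAlgebraic.trdeg_le_cardinalMk k (Set.range fun i => g (X i))).trans ?_
  refine Cardinal.mk_range_le.trans ?_
  simpa using hdn

theorem derivation_eq_zero_of_isAlgebraic {k A L : Type} [Field k] [CommRing A] [IsDomain A]
    [CharZero A] [Algebra k A] [Field L] [Algebra k L] [Algebra A L] [FaithfulSMul A L]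
    [IsScalarTower k A L] {s : Set A} [halg : Algebra.IsAlgebraic (Algebra.adjoin k s) A]
    (D : Derivation k A L) (hD : ∀ x ∈ s, D x = 0) : D = 0 := by
  have hC : ∀ c : Algebra.adjoin k s, D (c : A) = 0 := fun c => by
    simpa using Derivation.eqOn_adjoin (D1 := D) (D2 := 0) (s := s)
      (fun x hx => by simp [hD x hx]) c.2
  have hmul : ∀ (c : Algebra.adjoin k s) (x : A), D (c • x) = c • D x := fun c x => by
    rw [Algebra.smul_def, Derivation.leibniz, Algebra.algebraMap_eq_smul_one]
    have : D (c • (1 : A)) = 0 := by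
      simpa [Subalgebra.smul_def] using hC c
    rw [this, smul_zero, add_zero, smul_assoc, one_smul]
  let D' : Derivation (Algebra.adjoin k s) A L := Derivation.mk'
    { toFun := D, map_add' := D.map_add, map_smul' := hmul } (fun a b => D.leibniz a b)
  ext x
  have key : ∀ (m : ℕ) (P : Polynomial (Algebra.adjoin k s)), P.natDegree ≤ m → P ≠ 0 →
      Polynomial.aeval x P = 0 → D' x = 0 := by
    intro m
    induction m with
    | zero =>
      intro P hPd hP hPx
      rw [Polynomial.eq_C_of_natDegree_le_zero hPd] at hPx hP
      simp at hPx hP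
      exact absurd hPx hP
    | succ m ih =>
      intro P hPd hP hPx
      by_cases hP' : Polynomial.aeval x (Polynomial.derivative P) = 0
      · by_cases h0 : P.natDegree = 0
        · exact ih P (by omega) hP hPx
        · refine ih _ ?_ ?_ hP'
          · have := Polynomial.natDegree_derivative_lt h0
            omega
          · intro h
            exact h0 (Polynomial.derivative_eq_zero.1 h)
      · have h := D'.map_aeval P x
        rw [hPx, map_zero, Algebra.smul_def] at h
        refine (mul_eq_zero.1 h.symm).resolve_left ?_
        rwa [map_eq_zero_iff _ (FaithfulSMul.algebraMap_injective A L)]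
  obtain ⟨P, hP, hPx⟩ := halg.isAlgebraic x
  exact key _ P le_rfl hP hPx

theorem derivation_aeval {k R M σ : Type} [CommRing k] [CommRing R] [Algebra k R] [AddCommGroup M]
    [Module k M] [Module R M] [IsScalarTower k R M] [Fintype σ] (D : Derivation k R M)
    (f : σ → R) (P : MvPolynomial σ k) :
    D (aeval f P) = ∑ j, aeval f (pderiv j P) • D (f j) := by
  classical
  induction P using MvPolynomial.induction_on with
  | C a => simp
  | add p q hp hq => simp [hp, hq, add_smul, Finset.sum_add_distrib]
  | mul_X p i hp =>
    simp [hp, Derivation.leibniz, pderiv_X, add_smul, Finset.sum_add_distrib, Pi.single_apply,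
      mul_smul, Finset.smul_sum, apply_ite, ite_smul]

theorem exists_linearCombination_derivation_eq_zero {k A L ι : Type} [Field k] [CommRing A]
    [IsDomain A] [CharZero A] [Algebra k A] [Field L] [Algebra k L] [Algebra A L]
    [FaithfulSMul A L] [IsScalarTower k A L] [Fintype ι] {x : ι → A}
    (hx : AlgebraicIndependent k x) {m : ℕ}
    (htr : Algebra.trdeg k A ≤ (Fintype.card ι + m : ℕ)) (D : Fin (m + 1) → Derivation k A L)
    (hD : ∀ l i, D l (x i) = 0) :
    ∃ c : Fin (m + 1) → L, c ≠ 0 ∧ ∀ a, ∑ l, c l * D l a = 0 := by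
  obtain ⟨t, ht, hbase⟩ := exists_isTranscendenceBasis_superset hx.coe_range
  have hcard : Cardinal.mk t ≤ (Fintype.card ι + m : ℕ) := hbase.cardinalMk_eq_trdeg.trans_le htr
  have hfin : t.Finite := Cardinal.lt_aleph0_iff_set_finite.1
    (hcard.trans_lt (Cardinal.natCast_lt_aleph0))
  have : Fintype t := hfin.fintype
  have : Fintype ↥(t \ Set.range x) := (hfin.subset Set.sdiff_subset).fintype
  have hdiff : Fintype.card ↥(t \ Set.range x) ≤ m := by
    have h1 : (t \ Set.range x).ncard + (Set.range x).ncard = t.ncard :=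
      Set.ncard_sdiff_add_ncard_of_subset ht hfin
    have h2 : (Set.range x).ncard = Fintype.card ι := by
      rw [← Set.image_univ, Set.ncard_image_of_injective _ hx.injective, Set.ncard_univ,
        Nat.card_eq_fintype_card]
    have h3 : t.ncard ≤ Fintype.card ι + m := by
      rw [← Nat.card_coe_set_eq, Nat.card_eq_fintype_card]
      rw [Cardinal.mk_fintype] at hcard
      exact_mod_cast hcard
    rw [← Nat.card_eq_fintype_card, Nat.card_coe_set_eq]
    lia
  let T : (Fin (m + 1) → L) →ₗ[L] (↥(t \ Set.range x) → L) :=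
    Matrix.mulVecLin (Matrix.of fun b l => D l (b : A))
  have hker : LinearMap.ker T ≠ ⊥ := LinearMap.ker_ne_bot_of_finrank_lt
    (by simpa using Nat.lt_succ_of_le hdiff)
  obtain ⟨c, hc, hc0⟩ := (Submodule.ne_bot_iff _).1 hker
  refine ⟨c, hc0, fun a => ?_⟩
  have : Algebra.IsAlgebraic (Algebra.adjoin k t) A := by
    have := hbase.isAlgebraic
    rwa [Subtype.range_coe] at this
  have hsum : ∀ a, (∑ l, c l • D l) a = ∑ l, c l * D l a := fun a => by
    rw [← Derivation.coeFnAddMonoidHom_apply, map_sum, Finset.sum_apply]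
    simp
  have key : ∑ l, c l • D l = 0 := by
    refine derivation_eq_zero_of_isAlgebraic (s := t) _ fun b hb => ?_
    rw [hsum]
    by_cases hbx : b ∈ Set.range x
    · obtain ⟨i, rfl⟩ := hbx
      simp [hD]
    · have := congrFun (LinearMap.mem_ker.1 hc) ⟨b, hb, hbx⟩
      simpa [T, Matrix.mulVec, dotProduct, mul_comm] using this
  rw [← hsum, key, Derivation.zero_apply]

theorem exists_linearIndependent_comp_fin {L V ι : Type} [Field L] [AddCommGroup V] [Module L V]
    [FiniteDimensional L V] (ρ : ι → V) :
    ∃ r : Fin (Module.finrank L (Submodule.span L (Set.range ρ))) → ι,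
      Submodule.span L (Set.range (ρ ∘ r)) = Submodule.span L (Set.range ρ) ∧
        LinearIndependent L (ρ ∘ r) := by
  obtain ⟨f, hf, hspan, hli⟩ := Submodule.exists_fun_fin_finrank_span_eq L (Set.range ρ)
  choose r hr using hf
  obtain rfl : ρ ∘ r = f := _root_.funext hr
  exact ⟨r, hspan, hli⟩

theorem exists_submatrix_det_ne_zero {L ι : Type} [Field L] {m n : ℕ} (ρ : ι → Fin n → L)
    (W : Submodule L (Fin n → L)) (hW : m + Module.finrank L W = n)
    (h : ∀ u, (∀ i, ρ i ⬝ᵥ u = 0) → u ∈ W) :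
    ∃ (r : Fin m → ι) (c : Fin m → Fin n),
      (Matrix.of fun a b => ρ (r a) (c b)).det ≠ 0 := by
  obtain ⟨g, hspan, hli⟩ := exists_linearIndependent_comp_fin (L := L) ρ
  have hd : m ≤ Module.finrank L (Submodule.span L (Set.range ρ)) := by
    let T := (Matrix.of (ρ ∘ g)).mulVecLin
    have hker : LinearMap.ker T ≤ W := by
      intro u hu
      refine h u fun i => ?_
      have hi : ρ i ∈ Submodule.span L (Set.range (ρ ∘ g)) :=
        hspan.symm ▸ Submodule.subset_span ⟨i, rfl⟩
      generalize ρ i = y at hi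
      induction hi using Submodule.span_induction with
      | mem y hy =>
        obtain ⟨a, rfl⟩ := hy
        exact congrFun (LinearMap.mem_ker.1 hu) a
      | zero => simp
      | add y z _ _ hy hz => rw [add_dotProduct, hy, hz, add_zero]
      | smul a y _ hy => rw [smul_dotProduct, hy, smul_zero]
    have h1 := T.finrank_range_add_finrank_ker
    have h2 := Submodule.finrank_mono hker
    have h3 := (LinearMap.range T).finrank_le
    simp only [Module.finrank_fintype_fun_eq_card, Fintype.card_fin] at h1 h3
    omega
  let P : Matrix (Fin m) (Fin n) L := Matrix.of (ρ ∘ g ∘ Fin.castLE hd)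
  have hrank : P.rank = m := by
    have hP : LinearIndependent L P.row := hli.comp _ (Fin.castLE_injective hd)
    simpa using hP.rank_matrix
  obtain ⟨c, -, hc⟩ := exists_linearIndependent_comp_fin (L := L) P.col
  rw [Matrix.rank_eq_finrank_span_cols] at hrank
  refine ⟨g ∘ Fin.castLE hd, c ∘ Fin.cast hrank.symm, ?_⟩
  have hQ := hc.comp _ (Fin.cast_injective hrank.symm)
  exact ((Matrix.isUnit_iff_isUnit_det _).1
    (Matrix.linearIndependent_cols_iff_isUnit.1 hQ)).ne_zero

theorem add_finrank_le_of_det_ne_zero {L : Type} [Field L] {m n : ℕ}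
    (ρ : Fin m → Fin n → L) (c : Fin m → Fin n) (hdet : (Matrix.of fun a b => ρ a (c b)).det ≠ 0)
    (M : Submodule L (Fin n → L)) (hM : ∀ u ∈ M, ∀ a, ρ a ⬝ᵥ u = 0) :
    m + Module.finrank L M ≤ n := by
  have hrank : m ≤ (Matrix.of ρ).rank := by
    have h1 := Matrix.rank_submatrix_le (Matrix.of ρ) id c
    have h2 : ((Matrix.of ρ).submatrix id c).rank = m := by
      exact (Matrix.rank_of_det_ne_zero hdet).trans (Fintype.card_fin m)
    omega
  have hker : M ≤ LinearMap.ker (Matrix.of ρ).mulVecLin := fun u hu => funext fun a => hM u hu a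
  have h1 := (Matrix.of ρ).mulVecLin.finrank_range_add_finrank_ker
  have h2 := Submodule.finrank_mono hker
  rw [← Matrix.rank] at h1
  simp only [Module.finrank_fintype_fun_eq_card, Fintype.card_fin] at h1
  omega

theorem map_coeff_eq_zero_of_forall_eval {K R L : Type} [Field K] [Infinite K] [CommRing R]
    [Algebra K R] [Field L] [Algebra K L] (l : R →ₗ[K] L) (P : MvPolynomial (Fin 2) R)
    (h : ∀ s t : K, s ≠ 0 → l (eval ![algebraMap K R s, algebraMap K R t] P) = 0)
    (d : Fin 2 →₀ ℕ) : l (coeff d P) = 0 := by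
  classical
  let Q : MvPolynomial (Fin 2) L := ∑ e ∈ P.support, monomial e (l (coeff e P))
  have hQ : Q = 0 := by
    refine funext_set (fun _ => algebraMap K L '' {0}ᶜ) (fun _ => ?_) fun x hx => ?_
    · exact (Set.finite_singleton _).infinite_compl.image (algebraMap K L).injective.injOn
    · obtain ⟨s, hs, hs'⟩ := hx 0 trivial
      obtain ⟨t, -, ht'⟩ := hx 1 trivial
      have := h s t hs
      rw [eval_eq', map_sum] at this
      rw [map_zero, ← this, map_sum]
      refine Finset.sum_congr rfl fun e _ => ?_
      rw [eval_monomial, Finsupp.prod_fintype _ _ (by simp)]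
      simp only [Fin.prod_univ_two, Matrix.cons_val_zero, Matrix.cons_val_one, ← hs', ← ht',
        ← map_pow, ← map_mul]
      rw [mul_comm (coeff e P), ← Algebra.smul_def, map_smul, Algebra.smul_def, mul_comm]
  have : coeff d Q = l (coeff d P) := by
    simp only [Q, coeff_sum, coeff_monomial, Finset.sum_ite_eq', mem_support_iff]
    split_ifs with hd
    · rfl
    · rw [not_not.1 hd, map_zero]
  rw [← this, hQ, coeff_zero]

section Fano

variable {K : Type} [Field K] {N : ℕ}

/-- The generic point `s • v + t • w` of the line with frame `(v, w)`, in frame coordinates. -/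
def framePoint (s t : K) (j : Fin (N + 1)) : MvPolynomial (Fin 2 × Fin (N + 1)) K :=
  C s * X (0, j) + C t * X (1, j)

theorem aeval_framePoint {L : Type} [CommRing L] [Algebra K L] (x : Fin 2 × Fin (N + 1) → L)
    (F : MvPolynomial (Fin (N + 1)) K) (s t : K) :
    aeval x (aeval (framePoint s t) F) = aeval (fun j => s • x (0, j) + t • x (1, j)) F := by
  rw [← AlgHom.comp_apply, comp_aeval]
  simp [framePoint, Algebra.smul_def]

/-- The polynomial `F(S • v + T • w)` whose coefficients generate the Fano ideal. -/
def frameExpansion (F : MvPolynomial (Fin (N + 1)) K) :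
    MvPolynomial (Fin 2) (MvPolynomial (Fin 2 × Fin (N + 1)) K) :=
  aeval (fun j : Fin (N + 1) =>
      (X 0 : MvPolynomial (Fin 2) (MvPolynomial (Fin 2 × Fin (N + 1)) K)) * C (X (0, j)) +
        X 1 * C (X (1, j))) F

theorem eval_frameExpansion (F : MvPolynomial (Fin (N + 1)) K) (s t : K) :
    eval ![algebraMap K _ s, algebraMap K _ t] (frameExpansion F) = aeval (framePoint s t) F := by
  have h : ∀ P : MvPolynomial (Fin 2) (MvPolynomial (Fin 2 × Fin (N + 1)) K),
      eval ![algebraMap K _ s, algebraMap K _ t] P =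
        ((aeval (R := MvPolynomial (Fin 2 × Fin (N + 1)) K)
          ![algebraMap K _ s, algebraMap K _ t]).restrictScalars K) P := fun P => rfl
  rw [h, frameExpansion, ← AlgHom.comp_apply, comp_aeval]
  congr 2
  ext1 j
  simp [framePoint, MvPolynomial.algebraMap_eq]

theorem coeff_frameExpansion_mem (F : MvPolynomial (Fin (N + 1)) K) (d : Fin 2 →₀ ℕ) :
    coeff d (frameExpansion F) ∈ fanoIdeal K F :=
  Ideal.subset_span ⟨d, rfl⟩

theorem aeval_framePoint_mem_fanoIdeal (F : MvPolynomial (Fin (N + 1)) K) (s t : K) :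
    aeval (framePoint s t) F ∈ fanoIdeal K F := by
  rw [← eval_frameExpansion, eval_eq']
  exact Ideal.sum_mem _ fun d _ => Ideal.mul_mem_right _ _ (coeff_frameExpansion_mem F d)

theorem mem_zeroLocus_fanoIdeal [Infinite K] {F : MvPolynomial (Fin (N + 1)) K}
    {x : Fin 2 × Fin (N + 1) → K} :
    x ∈ zeroLocus K (fanoIdeal K F) ↔
      ∀ s t : K, eval (fun j => s * x (0, j) + t * x (1, j)) F = 0 := by
  have key : ∀ s t : K, aeval x (aeval (framePoint s t) F) =
      eval (fun j => s * x (0, j) + t * x (1, j)) F := fun s t => by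
    rw [aeval_framePoint]; rfl
  refine ⟨fun hx s t => key s t ▸ hx _ (aeval_framePoint_mem_fanoIdeal F s t), fun hx => ?_⟩
  have hle : fanoIdeal K F ≤ RingHom.ker (aeval x : MvPolynomial _ K →ₐ[K] K) := by
    refine Ideal.span_le.2 ?_
    rintro _ ⟨d, rfl⟩
    exact map_coeff_eq_zero_of_forall_eval (aeval x).toLinearMap (frameExpansion F)
      (fun s t _ => by rw [eval_frameExpansion, AlgHom.toLinearMap_apply, key, hx]) d
  exact fun p hp => hle hp

theorem derivation_eq_zero_of_mem_fanoIdeal [Infinite K] {L : Type} [Field L] [Algebra K L]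
    [Algebra (MvPolynomial (Fin 2 × Fin (N + 1)) K) L]
    [IsScalarTower K (MvPolynomial (Fin 2 × Fin (N + 1)) K) L]
    {F : MvPolynomial (Fin (N + 1)) K}
    (hL : ∀ x ∈ fanoIdeal K F, algebraMap (MvPolynomial (Fin 2 × Fin (N + 1)) K) L x = 0)
    (D : Derivation K (MvPolynomial (Fin 2 × Fin (N + 1)) K) L)
    (hD : ∀ s t : K, s ≠ 0 → D (aeval (framePoint s t) F) = 0)
    {x : MvPolynomial (Fin 2 × Fin (N + 1)) K} (hx : x ∈ fanoIdeal K F) : D x = 0 := by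
  induction hx using Submodule.span_induction with
  | mem y hy =>
    obtain ⟨d, rfl⟩ := hy
    exact map_coeff_eq_zero_of_forall_eval D.toLinearMap (frameExpansion F)
      (fun s t hs => by rw [eval_frameExpansion]; exact hD s t hs) d
  | zero => exact map_zero D
  | add y z _ _ hy hz => rw [map_add, hy, hz, add_zero]
  | smul a y hy' hy =>
    rw [smul_eq_mul, Derivation.leibniz, hy, smul_zero, zero_add, Algebra.smul_def, hL y hy',
      zero_mul]

theorem derivation_eq_zero_of_mem_minimalPrime {R K M : Type} [CommRing R] [CommRing K]
    [Algebra K R] [Field M] [Algebra K M] [Algebra R M] [IsScalarTower K R M] {I p : Ideal R}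
    (hI : GenericallyReducedIdeal I) (hp : p ∈ I.minimalPrimes)
    (hM : ∀ x, algebraMap R M x = 0 ↔ x ∈ p) (D : Derivation K R M) (hD : ∀ x ∈ I, D x = 0)
    {x : R} (hx : x ∈ p) : D x = 0 := by
  obtain ⟨s, hs, hsx⟩ := hI p hp x hx
  have := hD _ hsx
  rw [Derivation.leibniz, Algebra.smul_def, Algebra.smul_def, (hM x).2 hx, zero_mul,
    add_zero] at this
  exact (mul_eq_zero.1 this).resolve_left fun h => hs ((hM s).1 h)

/-- The `2 × 2` minor of the generic frame `(v, w)` on the columns `i`, `j`. -/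
def frameMinor (i j : Fin (N + 1)) : MvPolynomial (Fin 2 × Fin (N + 1)) K :=
  X (0, i) * X (1, j) - X (0, j) * X (1, i)

theorem linearIndependent_of_minor_ne_zero {L ι : Type} [Field L] {v w : ι → L} {i j : ι}
    (h : v i * w j - v j * w i ≠ 0) : LinearIndependent L ![v, w] := by
  rw [LinearIndependent.pair_iff]
  intro s t hst
  have hi := congrFun hst i
  have hj := congrFun hst j
  simp only [Pi.add_apply, Pi.smul_apply, smul_eq_mul, Pi.zero_apply] at hi hj
  constructor
  · refine (mul_eq_zero.1 (?_ : s * (v i * w j - v j * w i) = 0)).resolve_right h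
    linear_combination w j * hi - w i * hj
  · refine (mul_eq_zero.1 (?_ : t * (v i * w j - v j * w i) = 0)).resolve_right h
    linear_combination v i * hj - v j * hi

theorem exists_minor_ne_zero {L ι : Type} [Field L] {v w : ι → L} (hv : v ≠ 0)
    (hw : w ∉ Submodule.span L {v}) : ∃ i j, v i * w j - v j * w i ≠ 0 := by
  by_contra! h
  obtain ⟨i, hi⟩ := Function.ne_iff.1 hv
  refine hw (Submodule.mem_span_singleton.2 ⟨w i / v i, _root_.funext fun j => ?_⟩)
  have := h i j
  simp only [Pi.zero_apply] at hi
  simp only [Pi.smul_apply, smul_eq_mul]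
  field_simp
  linear_combination -this

theorem eval_eq_zero_of_mem_fanoSet {F : MvPolynomial (Fin (N + 1)) K} {W : Grass K 2 N}
    (hW : W ∈ fanoSet K F) {v : Fin (N + 1) → K} (hv : v ∈ W.1) (hv0 : v ≠ 0) :
    eval v F = 0 := by
  have : Projectivization.mk K v hv0 ∈ projZeros K F := hW (by
    simpa [projLinear, Projectivization.submodule_mk] using hv)
  exact this v (by simp [Projectivization.submodule_mk])

theorem exists_mem_fanoSet_of_mem_zeroLocus [Infinite K] {F : MvPolynomial (Fin (N + 1)) K}
    {x : Fin 2 × Fin (N + 1) → K} (hx : x ∈ zeroLocus K (fanoIdeal K F)) {i j : Fin (N + 1)}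
    (hij : eval x (frameMinor i j) ≠ 0) : ∃ W ∈ fanoSet K F, frameMem K x W.1 := by
  have hli : LinearIndependent K ![fun j => x (0, j), fun j => x (1, j)] :=
    linearIndependent_of_minor_ne_zero (i := i) (j := j) (by simpa [frameMinor] using hij)
  refine ⟨⟨Submodule.span K (Set.range ![fun j => x (0, j), fun j => x (1, j)]), ?_⟩, ?_, ?_⟩
  · simpa using finrank_span_eq_card hli
  · intro y hy v hv
    have hv' : v ∈ Submodule.span K (Set.range ![fun j => x (0, j), fun j => x (1, j)]) := hy hv
    rw [Matrix.range_cons, Matrix.range_cons, Matrix.range_empty, Set.union_empty,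
      Set.singleton_union, Submodule.mem_span_pair] at hv'
    obtain ⟨s, t, rfl⟩ := hv'
    exact mem_zeroLocus_fanoIdeal.1 hx s t
  · intro a
    exact Submodule.subset_span ⟨a, by fin_cases a <;> rfl⟩

theorem eval_smul_of_isHomogeneous {R σ : Type} [CommSemiring R] {F : MvPolynomial σ R} {n : ℕ}
    (hF : F.IsHomogeneous n) (c : R) (v : σ → R) : eval (c • v) F = c ^ n * eval v F := by
  rw [eval_eq, eval_eq, Finset.mul_sum]
  refine Finset.sum_congr rfl fun d hd => ?_
  have hd' : ∑ i ∈ d.support, d i = n := by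
    rw [← hF (mem_support_iff.1 hd), Finsupp.weight_apply, Finsupp.sum]
    simp
  simp only [Pi.smul_apply, smul_eq_mul, mul_pow, Finset.prod_mul_distrib, Finset.prod_pow_eq_pow_sum,
    hd']
  ring

theorem not_forall_X_dvd {k : Type} [Field k] {F : MvPolynomial (Fin 5) k} (hF : Irreducible F) :
    ∃ i, ¬ F ∣ X i := by
  by_contra! h
  have h0 : X 0 ∣ F := (hF.dvd_symm (X_prime (R := k) (i := 0)).irreducible) (h 0)
  have := h0.trans (h 1)
  rw [X_dvd_X] at this
  simp at this

theorem dvd_of_forall_eval_eq_zero [IsAlgClosed K] {F f : MvPolynomial (Fin 5) K}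
    (hF : Irreducible F) (hf : ∀ v, v ≠ 0 → eval v F = 0 → eval v f = 0) : F ∣ f := by
  obtain ⟨i, hi⟩ := not_forall_X_dvd hF
  have hmem : f * X i ∈ vanishingIdeal K (zeroLocus K (Ideal.span {F})) := by
    intro v hv
    have hFv : eval v F = 0 := hv F (Ideal.mem_span_singleton_self F)
    change eval v (f * X i) = 0
    rw [map_mul, eval_X]
    by_cases h0 : v = 0
    · simp [h0]
    · rw [hf v h0 hFv, zero_mul]
  rw [vanishingIdeal_zeroLocus_eq_radical,
    ((Ideal.span_singleton_prime hF.ne_zero).2 hF.prime).radical,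
    Ideal.mem_span_singleton] at hmem
  exact (hF.prime.dvd_or_dvd hmem).resolve_right hi

theorem exists_dominant_minimalPrime [IsAlgClosed K] {F : MvPolynomial (Fin 5) K}
    {n : ℕ} (hdeg : F.IsHomogeneous n) (hF : Irreducible F) (hcov : CoveredByLines K F) :
    ∃ p ∈ (fanoIdeal K F).minimalPrimes,
      (∀ f : MvPolynomial (Fin 5) K, rename (fun j => ((0 : Fin 2), j)) f ∈ p → F ∣ f) ∧
        ∃ i j, frameMinor i j ∉ p := by
  by_contra! h
  have hex : ∀ p ∈ (fanoIdeal K F).minimalPrimes, ∃ f : MvPolynomial (Fin 5) K, ¬ F ∣ f ∧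
      ∀ i j, rename (fun j => ((0 : Fin 2), j)) f * frameMinor i j ∈ p := by
    intro p hp
    by_cases hpf : ∀ f : MvPolynomial (Fin 5) K, rename (fun j => ((0 : Fin 2), j)) f ∈ p → F ∣ f
    · exact ⟨1, fun h1 => hF.not_isUnit (isUnit_of_dvd_one h1),
        fun i j => Ideal.mul_mem_left _ _ (h p hp hpf i j)⟩
    · push Not at hpf
      obtain ⟨f, hfp, hf⟩ := hpf
      exact ⟨f, hf, fun i j => Ideal.mul_mem_right _ _ hfp⟩
  choose! g hgF hg using hex
  have hfin : (fanoIdeal K F).minimalPrimes.Finite :=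
    Ideal.finite_minimalPrimes_of_isNoetherianRing _ _
  let f := ∏ p ∈ hfin.toFinset, g p
  have hfF : ¬ F ∣ f := fun hdvd => by
    obtain ⟨p, hp, hpd⟩ := (hF.prime.dvd_finsetProd_iff _).1 hdvd
    exact hgF p (hfin.mem_toFinset.1 hp) hpd
  refine hfF (dvd_of_forall_eval_eq_zero hF fun v hv hFv => ?_)
  have hmem : ∀ i j, rename (fun j => ((0 : Fin 2), j)) f * frameMinor i j ∈
      (fanoIdeal K F).radical := by
    intro i j
    rw [← Ideal.sInf_minimalPrimes]
    refine Ideal.mem_sInf.2 fun {p} hp => ?_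
    have hdvd : g p ∣ f := Finset.dvd_prod_of_mem g (hfin.mem_toFinset.2 hp)
    obtain ⟨q, hq⟩ := hdvd
    rw [hq, map_mul, mul_right_comm]
    exact Ideal.mul_mem_right _ _ (hg p hp i j)
  have hx : Projectivization.mk K v hv ∈ projZeros K F := by
    intro u hu
    rw [Projectivization.submodule_mk, Submodule.mem_span_singleton] at hu
    obtain ⟨c, rfl⟩ := hu
    rw [eval_smul_of_isHomogeneous hdeg, hFv, mul_zero]
  obtain ⟨W, hW, hxW⟩ := hcov _ hx
  have hvW : v ∈ W.1 := hxW (by simp [Projectivization.submodule_mk])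
  obtain ⟨w, hwW, hw⟩ : ∃ w ∈ W.1, w ∉ Submodule.span K {v} := by
    by_contra! hle
    have h1 := Submodule.finrank_mono (show W.1 ≤ Submodule.span K {v} from hle)
    rw [W.2, finrank_span_singleton hv] at h1
    omega
  obtain ⟨i, j, hij⟩ := exists_minor_ne_zero hv hw
  let x : Fin 2 × Fin 5 → K := fun a => ![v, w] a.1 a.2
  have hxI : x ∈ zeroLocus K (fanoIdeal K F) := mem_zeroLocus_fanoIdeal.2 fun s t => by
    by_cases h0 : s • v + t • w = 0
    · have : (fun j => s * x (0, j) + t * x (1, j)) = 0 := h0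
      rw [this]
      exact hx 0 (zero_mem _)
    · exact eval_eq_zero_of_mem_fanoSet hW
        (W.1.add_mem (W.1.smul_mem s hvW) (W.1.smul_mem t hwW)) h0
  rw [← vanishingIdeal_zeroLocus_eq_radical (K := K)] at hmem
  have := hmem i j x hxI
  change eval x _ = 0 at this
  rw [map_mul, eval_rename] at this
  refine (mul_eq_zero.1 this).resolve_right ?_
  simpa [frameMinor, x] using hij

theorem affVanishing_frameCone_le [IsAlgClosed K] {F : MvPolynomial (Fin (N + 1)) K}
    {p : Ideal (MvPolynomial (Fin 2 × Fin (N + 1)) K)} (hp : p ∈ (fanoIdeal K F).minimalPrimes)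
    {i j : Fin (N + 1)} (hij : frameMinor i j ∉ p) :
    affVanishing K (frameCone K 2 N (fanoSet K F)) ≤ p := by
  intro f hf
  have hpp : p.IsPrime := hp.1.1
  have : f * frameMinor i j ∈ (fanoIdeal K F).radical := by
    rw [← vanishingIdeal_zeroLocus_eq_radical (K := K)]
    intro x hx
    change eval x _ = 0
    rw [map_mul]
    by_cases h0 : eval x (frameMinor i j) = 0
    · rw [h0, mul_zero]
    · obtain ⟨W, hW, hxW⟩ := exists_mem_fanoSet_of_mem_zeroLocus hx h0
      rw [hf x ⟨W, hW, hxW⟩, zero_mul]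
  exact (hpp.mem_or_mem (hpp.radical_le_iff.2 hp.1.2 this)).resolve_right hij

theorem exists_algebraicIndependent {A : Type} [CommRing A] [Algebra K A]
    {F : MvPolynomial (Fin 5) K} (hF : Irreducible F) (x : Fin 5 → A)
    (hx : ∀ f : MvPolynomial (Fin 5) K, aeval x f = 0 → F ∣ f) :
    ∃ i : Fin 5, AlgebraicIndependent K fun j : {j // j ≠ i} => x j := by
  obtain ⟨i, hi⟩ : F.vars.Nonempty := by
    rw [Finset.nonempty_iff_ne_empty]
    intro h
    rw [vars_eq_empty_iff_eq_C] at h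
    have hc : constantCoeff F ≠ 0 := fun h0 => hF.ne_zero (by rw [h, ← constantCoeff_eq, h0, C_0])
    rw [constantCoeff_eq] at hc
    exact hF.not_isUnit (h ▸ (isUnit_iff_ne_zero.2 hc).map C)
  refine ⟨i, (algebraicIndependent_iff).2 fun f hf => ?_⟩
  have hdvd : F ∣ rename ((↑) : {j // j ≠ i} → Fin 5) f := hx _ (by rw [aeval_rename]; exact hf)
  by_contra hf0
  have hr : rename ((↑) : {j // j ≠ i} → Fin 5) f ≠ 0 := by
    rwa [Ne, map_eq_zero_iff _ (rename_injective _ Subtype.val_injective)]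
  obtain ⟨q, hq⟩ := hdvd
  have hq0 : q ≠ 0 := by rintro rfl; simp at hq; contradiction
  have h1 : degreeOf i (rename ((↑) : {j // j ≠ i} → Fin 5) f) = 0 := by
    by_contra h
    rw [← Ne, ← mem_vars_iff_degreeOf_ne_zero] at h
    obtain ⟨j, -, hj⟩ := mem_vars_rename _ _ h
    exact j.2 hj
  rw [hq, degreeOf_mul_eq hF.ne_zero hq0] at h1
  exact mem_vars_iff_degreeOf_ne_zero.1 hi (Nat.eq_zero_of_add_eq_zero_right h1)

theorem sum_aeval_pderiv_mul_eq_zero [Infinite K] {L : Type} [Field L] [Algebra K L]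
    {v w : Fin (N + 1) → L} {F : MvPolynomial (Fin (N + 1)) K}
    (h : ∀ s t : K, aeval (fun j => s • v j + t • w j) F = 0) (s t : K) (a : Fin 2) :
    ∑ j, aeval (fun j => s • v j + t • w j) (pderiv j F) * ![v, w] a j = 0 := by
  let g : Fin (N + 1) → MvPolynomial (Fin 2) L := fun j => C (v j) * X 0 + C (w j) * X 1
  have hg : ∀ (s t : K) (P : MvPolynomial (Fin (N + 1)) K),
      eval ![algebraMap K L s, algebraMap K L t] (aeval g P) =
        aeval (fun j => s • v j + t • w j) P := by
    intro s t P
    change ((aeval (R := L) ![algebraMap K L s, algebraMap K L t]).restrictScalars K) _ = _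
    rw [← AlgHom.comp_apply, comp_aeval]
    congr 2
    ext1 j
    simp [g, Algebra.smul_def, mul_comm]
  have h0 : aeval g F = 0 := by
    refine funext_set (fun _ => Set.range (algebraMap K L))
      (fun _ => Set.infinite_range_of_injective (algebraMap K L).injective) fun x hx => ?_
    obtain ⟨s, hs⟩ := hx 0 trivial
    obtain ⟨t, ht⟩ := hx 1 trivial
    have hx' : x = ![algebraMap K L s, algebraMap K L t] := by
      ext b
      fin_cases b
      · exact hs.symm
      · exact ht.symm
    rw [hx', hg, h, map_zero]
  have h1 := congrArg (eval ![algebraMap K L s, algebraMap K L t])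
    (derivation_aeval ((pderiv a : Derivation L (MvPolynomial (Fin 2) L) _).restrictScalars K) g F)
  rw [h0, map_zero, map_zero, map_sum] at h1
  rw [h1]
  refine Finset.sum_congr rfl fun j _ => ?_
  rw [smul_eq_mul, map_mul, hg]
  congr 1
  fin_cases a <;> simp [g, pderiv_X]

theorem exists_derivation_quotient {k R M : Type} [CommRing k] [CommRing R] [Algebra k R]
    [AddCommGroup M] [Module k M] [Module R M] (p : Ideal R) [Module (R ⧸ p) M]
    [IsScalarTower R (R ⧸ p) M] (D : Derivation k R M) (hD : ∀ x ∈ p, D x = 0) :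
    ∃ D' : Derivation k (R ⧸ p) M, ∀ x, D' (Ideal.Quotient.mk p x) = D x := by
  let l : (R ⧸ p) →ₗ[k] M :=
    (p.restrictScalars k).liftQ D.toLinearMap (fun x hx => hD x hx)
  have hl : ∀ x, l (Ideal.Quotient.mk p x) = D x := fun x => rfl
  refine ⟨Derivation.mk' l fun a b => ?_, hl⟩
  obtain ⟨a, rfl⟩ := Ideal.Quotient.mk_surjective a
  obtain ⟨b, rfl⟩ := Ideal.Quotient.mk_surjective b
  rw [← map_mul, hl, hl, hl, Derivation.leibniz]
  simp only [← Ideal.Quotient.algebraMap_eq, algebraMap_smul]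

theorem trdeg_quotient_le_of_hasGrDim [IsAlgClosed K] {F : MvPolynomial (Fin (N + 1)) K} {d : ℕ}
    (hdim : HasGrDim K (fanoSet K F) d) {p : Ideal (MvPolynomial (Fin 2 × Fin (N + 1)) K)}
    (hp : p ∈ (fanoIdeal K F).minimalPrimes) {i j : Fin (N + 1)} (hij : frameMinor i j ∉ p) :
    Algebra.trdeg K (MvPolynomial (Fin 2 × Fin (N + 1)) K ⧸ p) ≤ (d + 4 : ℕ) := by
  have : p.IsPrime := hp.1.1
  refine trdeg_le_of_ringKrullDim_le ?_
  exact (ringKrullDim_le_of_surjective _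
    (Ideal.Quotient.factor_surjective (affVanishing_frameCone_le hp hij))).trans hdim.le

theorem algebraMap_aeval_framePoint {L : Type} [CommRing L] [Algebra K L]
    [Algebra (MvPolynomial (Fin 2 × Fin (N + 1)) K) L]
    [IsScalarTower K (MvPolynomial (Fin 2 × Fin (N + 1)) K) L]
    (P : MvPolynomial (Fin (N + 1)) K) (s t : K) :
    algebraMap (MvPolynomial (Fin 2 × Fin (N + 1)) K) L (aeval (framePoint s t) P) =
      aeval (fun j => s • algebraMap (MvPolynomial (Fin 2 × Fin (N + 1)) K) L (X (0, j)) +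
        t • algebraMap (MvPolynomial (Fin 2 × Fin (N + 1)) K) L (X (1, j))) P := by
  rw [← aeval_framePoint (fun a => algebraMap (MvPolynomial (Fin 2 × Fin (N + 1)) K) L (X a))]
  have : IsScalarTower.toAlgHom K (MvPolynomial (Fin 2 × Fin (N + 1)) K) L =
      aeval (fun a => algebraMap (MvPolynomial (Fin 2 × Fin (N + 1)) K) L (X a)) :=
    algHom_ext fun a => by simp
  exact DFunLike.congr_fun this _

/-- A first order deformation of the generic line moving only its second frame vector, in a
direction tangent to the hypersurface along the line, gives a derivation of the function field of
the component. -/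
theorem exists_derivation_of_forall_sum_pderiv_mul_eq_zero [Infinite K]
    {F : MvPolynomial (Fin (N + 1)) K} (hred : FanoGenerallyReduced K F)
    {p : Ideal (MvPolynomial (Fin 2 × Fin (N + 1)) K)} (hp : p ∈ (fanoIdeal K F).minimalPrimes)
    {L : Type} [Field L] [Algebra K L] [Algebra (MvPolynomial (Fin 2 × Fin (N + 1)) K) L]
    [IsScalarTower K (MvPolynomial (Fin 2 × Fin (N + 1)) K) L]
    [Module (MvPolynomial (Fin 2 × Fin (N + 1)) K ⧸ p) L]
    [IsScalarTower (MvPolynomial (Fin 2 × Fin (N + 1)) K)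
      (MvPolynomial (Fin 2 × Fin (N + 1)) K ⧸ p) L]
    (hker : ∀ x, algebraMap (MvPolynomial (Fin 2 × Fin (N + 1)) K) L x = 0 ↔ x ∈ p)
    {u : Fin (N + 1) → L}
    (hu : ∀ s t : K, s ≠ 0 → ∑ l, algebraMap (MvPolynomial (Fin 2 × Fin (N + 1)) K) L
      (aeval (framePoint s t) (pderiv l F)) * u l = 0) :
    ∃ D : Derivation K (MvPolynomial (Fin 2 × Fin (N + 1)) K ⧸ p) L,
      ∀ a l, D (Ideal.Quotient.mk p (X (a, l))) = ![0, u] a l := by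
  let D : Derivation K (MvPolynomial (Fin 2 × Fin (N + 1)) K) L :=
    mkDerivation K fun a => ![0, u] a.1 a.2
  have hDX : ∀ a l, D (X (a, l)) = ![0, u] a l := fun a l => mkDerivation_X ..
  have hDF : ∀ s t : K, s ≠ 0 → D (aeval (framePoint s t) F) = 0 := by
    intro s t hs
    rw [derivation_aeval, ← mul_zero (algebraMap K L t), ← hu s t hs, Finset.mul_sum]
    refine Finset.sum_congr rfl fun l _ => ?_
    simp only [framePoint, map_add, ← MvPolynomial.algebraMap_eq, ← Algebra.smul_def,
      Derivation.map_smul, hDX]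
    simp only [Matrix.cons_val_zero, Matrix.cons_val_one, Pi.zero_apply,
      Algebra.smul_def]
    ring
  obtain ⟨D', hD'⟩ := exists_derivation_quotient p D fun x hx =>
    derivation_eq_zero_of_mem_minimalPrime hred hp hker D
      (fun x hx => derivation_eq_zero_of_mem_fanoIdeal
        (fun x hx => (hker x).2 (hp.1.2 hx)) D hDF hx) hx
  exact ⟨D', fun a l => by rw [hD', hDX]⟩

theorem mem_span_of_forall_sum_pderiv_mul_eq_zero [IsAlgClosed K] [CharZero K]
    {F : MvPolynomial (Fin 5) K} (hF : Irreducible F) (hdim : HasGrDim K (fanoSet K F) 2)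
    (hred : FanoGenerallyReduced K F) {p : Ideal (MvPolynomial (Fin 2 × Fin 5) K)}
    (hp : p ∈ (fanoIdeal K F).minimalPrimes)
    (hdom : ∀ f : MvPolynomial (Fin 5) K, rename (fun j => ((0 : Fin 2), j)) f ∈ p → F ∣ f)
    {i j : Fin 5} (hij : frameMinor i j ∉ p) {L : Type} [Field L] [Algebra K L]
    [Algebra (MvPolynomial (Fin 2 × Fin 5) K) L]
    [IsScalarTower K (MvPolynomial (Fin 2 × Fin 5) K) L]
    [Algebra (MvPolynomial (Fin 2 × Fin 5) K ⧸ p) L]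
    [IsScalarTower (MvPolynomial (Fin 2 × Fin 5) K) (MvPolynomial (Fin 2 × Fin 5) K ⧸ p) L]
    [IsScalarTower K (MvPolynomial (Fin 2 × Fin 5) K ⧸ p) L]
    [FaithfulSMul (MvPolynomial (Fin 2 × Fin 5) K ⧸ p) L] {u : Fin 5 → L}
    (hu : ∀ s t : K, s ≠ 0 → ∑ l, algebraMap (MvPolynomial (Fin 2 × Fin 5) K) L
      (aeval (framePoint s t) (pderiv l F)) * u l = 0) :
    u ∈ Submodule.span L (Set.range
      ![fun l => algebraMap (MvPolynomial (Fin 2 × Fin 5) K) L (X (0, l)),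
        fun l => algebraMap (MvPolynomial (Fin 2 × Fin 5) K) L (X (1, l))]) := by
  have hpp : p.IsPrime := hp.1.1
  have hker : ∀ x, algebraMap (MvPolynomial (Fin 2 × Fin 5) K) L x = 0 ↔ x ∈ p := fun x => by
    rw [IsScalarTower.algebraMap_apply (MvPolynomial (Fin 2 × Fin 5) K)
        (MvPolynomial (Fin 2 × Fin 5) K ⧸ p) L,
      map_eq_zero_iff _ (FaithfulSMul.algebraMap_injective (MvPolynomial (Fin 2 × Fin 5) K ⧸ p) L),
      Ideal.Quotient.algebraMap_eq, Ideal.Quotient.eq_zero_iff_mem]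
  set v : Fin 5 → L := fun l => algebraMap (MvPolynomial (Fin 2 × Fin 5) K) L (X (0, l)) with hv
  set w : Fin 5 → L := fun l => algebraMap (MvPolynomial (Fin 2 × Fin 5) K) L (X (1, l)) with hw
  have hFp : ∀ s t : K, aeval (fun j => s • v j + t • w j) F = 0 := fun s t => by
    rw [← algebraMap_aeval_framePoint, hker]
    exact hp.1.2 (aeval_framePoint_mem_fanoIdeal F s t)
  have hli : LinearIndependent L ![v, w] := by
    refine linearIndependent_of_minor_ne_zero (i := i) (j := j) fun h => hij ((hker _).1 ?_)
    simpa [frameMinor, hv, hw] using h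
  by_contra hmem
  have hli3 : LinearIndependent L (Fin.cons u ![v, w] : Fin 3 → Fin 5 → L) :=
    linearIndependent_finCons.2 ⟨hli, hmem⟩
  have hdes3 : ∀ b : Fin 3, ∃ D : Derivation K (MvPolynomial (Fin 2 × Fin 5) K ⧸ p) L, ∀ a l,
      D (Ideal.Quotient.mk p (X (a, l))) =
        ![0, (Fin.cons u ![v, w] : Fin 3 → Fin 5 → L) b] a l := by
    intro b
    refine exists_derivation_of_forall_sum_pderiv_mul_eq_zero hred hp hker fun s t hs => ?_
    refine Fin.cases (hu s t hs) (fun b => ?_) b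
    simp only [algebraMap_aeval_framePoint]
    exact sum_aeval_pderiv_mul_eq_zero hFp s t b
  choose D hD using hdes3
  obtain ⟨i₀, hi₀⟩ := exists_algebraicIndependent hF
    (fun l => Ideal.Quotient.mk p (X (0, l))) fun f hf => hdom f (by
      rw [← Ideal.Quotient.eq_zero_iff_mem, ← hf]
      have : (Ideal.Quotient.mkₐ K p).comp (rename fun j => ((0 : Fin 2), j)) =
        aeval (fun l => Ideal.Quotient.mk p (X (0, l))) := algHom_ext fun a => by simp
      exact DFunLike.congr_fun this f)
  have : CharZero (MvPolynomial (Fin 2 × Fin 5) K ⧸ p) :=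
    charZero_of_injective_algebraMap (algebraMap K (MvPolynomial (Fin 2 × Fin 5) K ⧸ p)).injective
  obtain ⟨c, hc, hcD⟩ := exists_linearCombination_derivation_eq_zero (m := 2) hi₀
    (by simpa using trdeg_quotient_le_of_hasGrDim hdim hp hij) D fun b l => by simp [hD]
  refine hc (_root_.funext (Fintype.linearIndependent_iff.1 hli3 c (_root_.funext fun l => ?_)))
  have := hcD (Ideal.Quotient.mk p (X (1, l)))
  simpa [hD] using this

theorem gradVec_dotProduct_eq_zero {F : MvPolynomial (Fin (N + 1)) K} {r : Grass K 2 N}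
    (hr : r ∈ fanoSet K F) {M : Submodule K (Fin (N + 1) → K)}
    (hM : ∀ q ∈ projLinear K r.1, SmoothAt K F q → projLinear K M ⊆ tangentHyp K F q)
    {q u : Fin (N + 1) → K} (hqr : q ∈ r.1) (hq : q ≠ 0) (hu : u ∈ M) :
    gradVec K F q ⬝ᵥ u = 0 := by
  have hqmem : Projectivization.mk K q hq ∈ projLinear K r.1 := by
    simpa [projLinear, Projectivization.submodule_mk] using hqr
  have hself : ∀ (y : Fin (N + 1) → K) (hy : y ≠ 0), y ∈ (Projectivization.mk K y hy).submodule :=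
    fun y hy => by simp [Projectivization.submodule_mk]
  by_cases hsing : Projectivization.mk K q hq ∈ singLocus K F
  · rw [hsing.2 q (hself q hq), zero_dotProduct]
  · by_cases hu0 : u = 0
    · rw [hu0, dotProduct_zero]
    · have humem : Projectivization.mk K u hu0 ∈ projLinear K M := by
        simpa [projLinear, Projectivization.submodule_mk] using hu
      exact hM _ hqmem ⟨hr hqmem, hsing⟩ humem q (hself q hq) u (hself u hu0)

end Fano

/-- if the Fano scheme is generically reduced, then for a general line
`r` of the family there is no plane containing `r` which is tangent to `X` at every
(general) smooth point of `r`. -/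
theorem no_fixed_tangent_plane_along_general_line
    (K : Type) [Field K] [IsAlgClosed K] [CharZero K]
    (n : ℕ) (F : MvPolynomial (Fin 5) K)
    (hdeg : F.IsHomogeneous n) (hIrr : Irreducible F)
    (hcov : CoveredByLines K F) (hdim : HasGrDim K (fanoSet K F) 2)
    (hred : FanoGenerallyReduced K F) :
    GenerallyOnGr K (fanoSet K F) (fun r =>
      ¬ ∃ M : Submodule K (Fin 5 → K), Module.finrank K M = 3 ∧ r.1 ≤ M ∧
        ∀ q ∈ projLinear K r.1, SmoothAt K F q → projLinear K M ⊆ tangentHyp K F q) := by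
  obtain ⟨p, hp, hdom, i, j, hij⟩ := exists_dominant_minimalPrime hdeg hIrr hcov
  have hpp : p.IsPrime := hp.1.1
  let L := FractionRing (MvPolynomial (Fin 2 × Fin 5) K ⧸ p)
  have hker : ∀ x, algebraMap (MvPolynomial (Fin 2 × Fin 5) K) L x = 0 ↔ x ∈ p := fun x => by
    rw [IsScalarTower.algebraMap_apply _ (MvPolynomial (Fin 2 × Fin 5) K ⧸ p) L,
      map_eq_zero_iff _ (FaithfulSMul.algebraMap_injective _ L),
      Ideal.Quotient.algebraMap_eq, Ideal.Quotient.eq_zero_iff_mem]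
  have hli : LinearIndependent L
      ![fun l => algebraMap (MvPolynomial (Fin 2 × Fin 5) K) L (X (0, l)),
        fun l => algebraMap (MvPolynomial (Fin 2 × Fin 5) K) L (X (1, l))] :=
    linearIndependent_of_minor_ne_zero (i := i) (j := j) fun h => hij ((hker _).1 (by
      simpa [frameMinor] using h))
  obtain ⟨ρ, c, hdet⟩ := exists_submatrix_det_ne_zero (m := 3)
    (fun (a : {a : K × K // a.1 ≠ 0}) l => algebraMap (MvPolynomial (Fin 2 × Fin 5) K) L
      (aeval (framePoint a.1.1 a.1.2) (pderiv l F)))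
    _ (by rw [finrank_span_eq_card hli, Fintype.card_fin]) fun u hu =>
      mem_span_of_forall_sum_pderiv_mul_eq_zero hIrr hdim hred hp hdom hij
        fun s t hs => hu ⟨(s, t), hs⟩
  let P : Matrix (Fin 3) (Fin 3) (MvPolynomial (Fin 2 × Fin 5) K) := Matrix.of fun a b =>
    aeval (framePoint (ρ a).1.1 (ρ a).1.2) (pderiv (c b) F)
  have hP : P.det ∉ p := fun h => hdet (by
    rw [← (hker _).2 h, RingHom.map_det]
    rfl)
  refine ⟨frameMinor i j * P.det, ?_, ?_⟩
  · have hG : frameMinor i j * P.det ∉ (fanoIdeal K F).radical := fun h =>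
      (hpp.mem_or_mem (hpp.radical_le_iff.2 hp.1.2 h)).elim hij hP
    rw [← vanishingIdeal_zeroLocus_eq_radical (K := K)] at hG
    obtain ⟨x, hx, hxG⟩ : ∃ x ∈ zeroLocus K (fanoIdeal K F),
        eval x (frameMinor i j * P.det) ≠ 0 := by
      by_contra! h
      exact hG h
    obtain ⟨W, hW, hxW⟩ := exists_mem_fanoSet_of_mem_zeroLocus (i := i) (j := j) hx
      (left_ne_zero_of_mul (by rwa [map_mul] at hxG))
    exact ⟨W, hW, x, hxW, hxG⟩
  · rintro r hr ⟨x, hxr, hxG⟩ ⟨M, hM3, -, hM⟩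
    rw [map_mul] at hxG
    have hlix : LinearIndependent K ![fun l => x (0, l), fun l => x (1, l)] :=
      linearIndependent_of_minor_ne_zero (i := i) (j := j)
        (by simpa [frameMinor] using left_ne_zero_of_mul hxG)
    have hrow : ∀ (a : Fin 3) (l : Fin 5),
        eval x (aeval (framePoint (ρ a).1.1 (ρ a).1.2) (pderiv l F)) =
          gradVec K F ((ρ a).1.1 • (fun l => x (0, l)) + (ρ a).1.2 • fun l => x (1, l)) l :=
      fun a l => aeval_framePoint x ..
    have := add_finrank_le_of_det_ne_zero
      (fun a => gradVec K F ((ρ a).1.1 • (fun l => x (0, l)) + (ρ a).1.2 • fun l => x (1, l))) c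
      (by
        convert right_ne_zero_of_mul hxG
        rw [RingHom.map_det]
        congr 1
        ext a b
        exact (hrow a (c b)).symm) M
      fun u hu a => gradVec_dotProduct_eq_zero hr hM
        (r.1.add_mem (r.1.smul_mem _ (hxr 0)) (r.1.smul_mem _ (hxr 1)))
        (fun h => (ρ a).2 (LinearIndependent.pair_iff.1 hlix _ _ h).1) hu
    erw [hM3] at this
    omega

end PaperLines
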